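/- arXiv:2211.14707 — 9 statements merged into one kernel-verified Lean document; each statement's English description precedes it below -/
import Mathlib

section
/- Every moderately meet continuous quasiexact poset is exact and meet continuous. That is, if P is a poset that is quasiexact and moderately meet continuous, then (i) for every x ∈ P the set {y ∈ P : y ≪_w x} is directed and its supremum is x, and (ii) for every x ∈ P and every directed subset D of P whose supremum exists, x ≤ sup D implies that x belongs to the Scott closure of ↓D ∩ ↓x. -/
open Set TopologicalSpace

variable {α : Type*}

/-- The upper closure `↑A = {p : ∃ a ∈ A, a ≤ p}`. -/
def upSet [PartialOrder α] (A : Set α) : Set α := {p | ∃ a ∈ A, a ≤ p}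

/-- The lower closure `↓A = {p : ∃ a ∈ A, p ≤ a}`. -/
def downSet [PartialOrder α] (A : Set α) : Set α := {p | ∃ a ∈ A, p ≤ a}

/-- A nonempty subset `D` is directed if every two elements have an upper bound in `D`. -/
def IsDirectedSet [PartialOrder α] (D : Set α) : Prop :=
  D.Nonempty ∧ ∀ a ∈ D, ∀ b ∈ D, ∃ c ∈ D, a ≤ c ∧ b ≤ c

/-- `G` is weakly way below `H` (`G ≪_w H`): for every directed `D` whose sup exists,
`sup D ∈ H` implies `d ∈ ↑G` for some `d ∈ D`. -/
def WWB [PartialOrder α] (G H : Set α) : Prop :=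
  ∀ D : Set α, IsDirectedSet D → ∀ s : α, IsLUB D s → s ∈ H → ∃ d ∈ D, d ∈ upSet G

/-- `↟_w G = {a : G ≪_w a}`. -/
def wUp [PartialOrder α] (G : Set α) : Set α := {a | WWB G {a}}

/-- `fin_w(x)`: all finite nonempty subsets `F` with `F ≪_w x`. -/
def finW [PartialOrder α] (x : α) : Set (Set α) :=
  {F | F.Finite ∧ F.Nonempty ∧ WWB F {x}}

/-- `fin_(bl)w(x) = {F ∈ fin_w(x) : F ⊆ ↓x}`. -/
def finBlW [PartialOrder α] (x : α) : Set (Set α) :=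
  {F | F ∈ finW x ∧ F ⊆ downSet {x}}

/-- A family `𝓕` of subsets is directed if for `F₁, F₂ ∈ 𝓕` there is `F₃ ∈ 𝓕`
with `F₃ ⊆ ↑F₁ ∩ ↑F₂`. -/
def DirectedFam [PartialOrder α] (𝓕 : Set (Set α)) : Prop :=
  ∀ F₁ ∈ 𝓕, ∀ F₂ ∈ 𝓕, ∃ F₃ ∈ 𝓕, F₃ ⊆ upSet F₁ ∩ upSet F₂

/-- `P` is quasiexact if for each `x` the family `fin_w(x)` is directed and
`⋂ {↑F : F ∈ fin_w(x)} = ↑x`. -/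
def Quasiexact (α : Type*) [PartialOrder α] : Prop :=
  ∀ x : α, DirectedFam (finW x) ∧ (⋂ F ∈ finW x, upSet F) = upSet {x}

/-- A dcpo: every directed subset has a supremum. -/
def IsDcpo (α : Type*) [PartialOrder α] : Prop :=
  ∀ D : Set α, IsDirectedSet D → ∃ s : α, IsLUB D s

/-- The wf topology: generated by the subbasis `{↟_w F : F finite nonempty}`. -/
def wfTopology (α : Type*) [PartialOrder α] : TopologicalSpace α :=
  generateFrom {U | ∃ F : Set α, F.Finite ∧ F.Nonempty ∧ U = wUp F}

/-- The wwb topology: generated by the subbasis `{↟_w x : x ∈ P}`. -/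
def wwbTopology (α : Type*) [PartialOrder α] : TopologicalSpace α :=
  generateFrom {U | ∃ x : α, U = wUp {x}}

/-- `P` is moderately meet continuous: `x ≤ sup D` implies
`x ∈ cl_{τ_wf}(↓D ∩ ↓x)` for every directed `D` whose sup exists. -/
def ModMeetCont (α : Type*) [PartialOrder α] : Prop :=
  ∀ x : α, ∀ D : Set α, IsDirectedSet D → ∀ s : α, IsLUB D s → x ≤ s →
    x ∈ @closure α (wfTopology α) (downSet D ∩ downSet {x})

/-- `U` is Scott open: `U = ↑U` and every directed set whose sup lies in `U` meets `U`. -/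
def IsScottOpen [PartialOrder α] (U : Set α) : Prop :=
  upSet U = U ∧
    ∀ D : Set α, IsDirectedSet D → ∀ s : α, IsLUB D s → s ∈ U → (D ∩ U).Nonempty

/-- The Scott topology. -/
def scottTopology (α : Type*) [PartialOrder α] : TopologicalSpace α :=
  generateFrom {U | IsScottOpen U}

/-- `P` is exact: for every `x` the set `{y : y ≪_w x}` is directed with supremum `x`. -/
def ExactPoset (α : Type*) [PartialOrder α] : Prop :=
  ∀ x : α, IsDirectedSet {y | WWB {y} {x}} ∧ IsLUB {y | WWB {y} {x}} x

/-- `x` is way below `y`: for every directed `D` whose sup exists,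
`y ≤ sup D` implies `x ≤ d` for some `d ∈ D`. -/
def WayBelowPt [PartialOrder α] (x y : α) : Prop :=
  ∀ D : Set α, IsDirectedSet D → ∀ s : α, IsLUB D s → y ≤ s → ∃ d ∈ D, x ≤ d

/-- `G` is way below `H`: for every directed `D` whose sup exists,
`sup D ∈ ↑H` implies `d ∈ ↑G` for some `d ∈ D`. -/
def WayBelowSet [PartialOrder α] (G H : Set α) : Prop :=
  ∀ D : Set α, IsDirectedSet D → ∀ s : α, IsLUB D s → s ∈ upSet H → ∃ d ∈ D, d ∈ upSet G

/-- `fin(x)`: all finite nonempty subsets `F` with `F ≪ x`. -/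
def finWB [PartialOrder α] (x : α) : Set (Set α) :=
  {F | F.Finite ∧ F.Nonempty ∧ WayBelowSet F {x}}

/-- The relation `≪_w` is weakly increasing: `x ≪_w y ≤ z ≪_w u` implies `x ≪_w z`. -/
def WeaklyIncreasing (α : Type*) [PartialOrder α] : Prop :=
  ∀ x y z u : α, WWB {x} {y} → y ≤ z → WWB {z} {u} → WWB {x} {z}

theorem isDirectedSet_singleton [PartialOrder α] (x : α) : IsDirectedSet ({x} : Set α) :=
  ⟨singleton_nonempty x, fun _ ha _ hb =>
    ⟨x, rfl, (mem_singleton_iff.1 ha).le, (mem_singleton_iff.1 hb).le⟩⟩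

theorem WWB.mem_upSet [PartialOrder α] {F : Set α} {x : α} (h : WWB F {x}) : x ∈ upSet F := by
  obtain ⟨d, rfl, hd⟩ := h {x} (isDirectedSet_singleton x) x isLUB_singleton rfl
  exact hd

theorem WWB.le [PartialOrder α] {x y : α} (h : WWB {x} {y}) : x ≤ y := by
  obtain ⟨a, rfl, ha⟩ := h.mem_upSet
  exact ha

/-- Moderate meet continuity, applied to the subbasic neighbourhood `↟_w F` of `x`. -/
theorem ModMeetCont.exists_le_wwb [PartialOrder α] (hmmc : ModMeetCont α) {F : Set α}
    (hfin : F.Finite) (hne : F.Nonempty) {x : α} (hF : WWB F {x}) {D : Set α}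
    (hD : IsDirectedSet D) {s : α} (hs : IsLUB D s) (hxs : x ≤ s) :
    ∃ y ≤ x, y ∈ downSet D ∧ WWB F {y} := by
  let _ : TopologicalSpace α := wfTopology α
  have hopen : IsOpen (wUp F) := isOpen_generateFrom_of_mem ⟨F, hfin, hne, rfl⟩
  obtain ⟨y, hyF, hyD, z, rfl, hyz⟩ := mem_closure_iff.1 (hmmc x D hD s hs hxs) _ hopen hF
  exact ⟨y, hyz, hyD, hyF⟩

/-- A finite set weakly way below `x` has an element weakly way below `x`. -/
theorem ModMeetCont.exists_mem_wwb [PartialOrder α] (hmmc : ModMeetCont α) {F : Set α}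
    (hfin : F.Finite) (hne : F.Nonempty) {x : α} (hF : WWB F {x}) :
    ∃ f ∈ F, WWB {f} {x} := by
  by_contra! hcon
  have hD : ∀ f ∈ F, ∃ D : Set α, IsDirectedSet D ∧ IsLUB D x ∧ f ∉ downSet D := by
    intro f hf
    have hnot := hcon f hf
    simp only [WWB] at hnot
    push Not at hnot
    obtain ⟨D, hD, s, hs, rfl, hfD⟩ := hnot
    exact ⟨D, hD, hs, fun ⟨d, hd, hfd⟩ => hfD d hd ⟨f, rfl, hfd⟩⟩
  have hG : ∀ G : Set α, G.Finite → G ⊆ F →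
      ∃ y ≤ x, WWB F {y} ∧ ∀ g ∈ G, ¬ g ≤ y := by
    intro G hGfin
    induction G, hGfin using Set.Finite.induction_on with
    | empty => exact fun _ => ⟨x, le_rfl, hF, by simp⟩
    | @insert a G _ _ ih =>
      intro hsub
      obtain ⟨y, hyx, hy, hyG⟩ := ih ((subset_insert a G).trans hsub)
      obtain ⟨D, hDdir, hDx, haD⟩ := hD a (hsub (mem_insert a G))
      obtain ⟨z, hzy, ⟨d, hd, hzd⟩, hz⟩ := hmmc.exists_le_wwb hfin hne hy hDdir hDx hyx
      refine ⟨z, hzy.trans hyx, hz, ?_⟩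
      rintro g (rfl | hg) hgz
      · exact haD ⟨d, hd, hgz.trans hzd⟩
      · exact hyG g hg (hgz.trans hzy)
  obtain ⟨y, _, hy, hyF⟩ := hG F hfin Subset.rfl
  obtain ⟨f, hf, hfy⟩ := hy.mem_upSet
  exact hyF f hf hfy

theorem Quasiexact.finW_nonempty [PartialOrder α] (hqe : Quasiexact α) (x : α) :
    (finW x).Nonempty := by
  by_contra hempty
  rw [not_nonempty_iff_eq_empty] at hempty
  have huniv := (hqe x).2
  rw [hempty, biInter_empty] at huniv
  have hx : ({x} : Set α) ∈ finW x := by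
    refine ⟨finite_singleton x, singleton_nonempty x, fun D hD _ _ _ => ?_⟩
    obtain ⟨d, hd⟩ := hD.1
    exact ⟨d, hd, huniv ▸ mem_univ d⟩
  simp [hempty] at hx

theorem Quasiexact.exactPoset [PartialOrder α] (hqe : Quasiexact α) (hmmc : ModMeetCont α) :
    ExactPoset α := by
  refine fun x => ⟨⟨?_, ?_⟩, fun y hy => WWB.le hy, fun u hu => ?_⟩
  · obtain ⟨F, hfin, hne, hF⟩ := hqe.finW_nonempty x
    obtain ⟨f, _, hf⟩ := hmmc.exists_mem_wwb hfin hne hF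
    exact ⟨f, hf⟩
  · intro a ha b hb
    obtain ⟨F, ⟨hfin, hne, hF⟩, hsub⟩ := (hqe x).1
      {a} ⟨finite_singleton a, singleton_nonempty a, ha⟩
      {b} ⟨finite_singleton b, singleton_nonempty b, hb⟩
    obtain ⟨f, hfF, hf⟩ := hmmc.exists_mem_wwb hfin hne hF
    obtain ⟨⟨_, rfl, haf⟩, ⟨_, rfl, hbf⟩⟩ := hsub hfF
    exact ⟨f, hf, haf, hbf⟩
  · have hmem : u ∈ ⋂ F ∈ finW x, upSet F := by
      refine mem_iInter₂.2 fun F ⟨hfin, hne, hF⟩ => ?_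
      obtain ⟨f, hfF, hf⟩ := hmmc.exists_mem_wwb hfin hne hF
      exact ⟨f, hfF, hu hf⟩
    rw [(hqe x).2] at hmem
    obtain ⟨_, rfl, hxu⟩ := hmem
    exact hxu

/-- In an exact poset, every Scott neighbourhood of `x` contains `↑y` for some `y ≪_w x`. -/
theorem ExactPoset.exists_wwb_of_isOpen [PartialOrder α] (hex : ExactPoset α) {U : Set α}
    (hU : @IsOpen α (scottTopology α) U) : ∀ x ∈ U, ∃ y, WWB {y} {x} ∧ ∀ z, y ≤ z → z ∈ U := by
  change GenerateOpen {U : Set α | IsScottOpen U} U at hU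
  induction hU with
  | basic V hV =>
    intro x hx
    obtain ⟨y, hyx, hyV⟩ := hV.2 _ (hex x).1 x (hex x).2 hx
    exact ⟨y, hyx, fun z hyz => hV.1 ▸ ⟨y, hyV, hyz⟩⟩
  | univ =>
    intro x _
    obtain ⟨y, hy⟩ := (hex x).1.1
    exact ⟨y, hy, fun z _ => mem_univ z⟩
  | inter V W _ _ ihV ihW =>
    intro x hx
    obtain ⟨a, ha, haV⟩ := ihV x hx.1
    obtain ⟨b, hb, hbW⟩ := ihW x hx.2
    obtain ⟨c, hc, hac, hbc⟩ := (hex x).1.2 a ha b hb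
    exact ⟨c, hc, fun z hz => ⟨haV z (hac.trans hz), hbW z (hbc.trans hz)⟩⟩
  | sUnion S _ ih =>
    rintro x ⟨V, hV, hx⟩
    obtain ⟨y, hy, hyV⟩ := ih V hV x hx
    exact ⟨y, hy, fun z hz => ⟨V, hV, hyV z hz⟩⟩

/-- Every moderately meet continuous quasiexact poset is exact and
meet continuous. -/
theorem moderately_meet_continuous_quasiexact_is_exact_and_meet_continuous
    [PartialOrder α] (hqe : Quasiexact α) (hmmc : ModMeetCont α) :
    ExactPoset α ∧
      (∀ x : α, ∀ D : Set α, IsDirectedSet D → ∀ s : α, IsLUB D s → x ≤ s →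
        x ∈ @closure α (scottTopology α) (downSet D ∩ downSet {x})) := by
  have hex := hqe.exactPoset hmmc
  refine ⟨hex, fun x D hD s hs hxs => ?_⟩
  let _ : TopologicalSpace α := scottTopology α
  refine mem_closure_iff.2 fun U hU hxU => ?_
  obtain ⟨y, hyx, hyU⟩ := hex.exists_wwb_of_isOpen hU x hxU
  obtain ⟨z, hzx, hzD, hyz⟩ :=
    hmmc.exists_le_wwb (finite_singleton y) (singleton_nonempty y) hyx hD hs hxs
  exact ⟨z, hyU z hyz.le, hzD, x, rfl, hzx⟩
end

section
/- A dcpo P is quasiexact if and only if for every x ∈ P there exists a directed subfamily 𝓕 ⊆ fin_(bl)w(x) such that ⋂{↑F : F ∈ 𝓕} = ↑x. -/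
open Set TopologicalSpace

variable {α : Type*}

theorem upSet_singleton_subset_iInter_finW [PartialOrder α] (x : α) :
    upSet {x} ⊆ ⋂ F ∈ finW x, upSet F := by
  rintro y ⟨_, rfl, hy⟩
  refine mem_iInter₂.2 fun F hF => ?_
  obtain ⟨f, hf, hfx⟩ := hF.2.2.mem_upSet
  exact ⟨f, hf, hfx.trans hy⟩

theorem inter_downSet_mem_finBlW [PartialOrder α] {F : Set α} {x : α} (hF : F ∈ finW x) :
    F ∩ downSet {x} ∈ finBlW x := by
  obtain ⟨hfin, -, hw⟩ := hF
  refine ⟨⟨hfin.subset inter_subset_left, ?_, ?_⟩, inter_subset_right⟩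
  · obtain ⟨f, hf, hfx⟩ := hw.mem_upSet
    exact ⟨f, hf, x, rfl, hfx⟩
  · rintro D hD s hs rfl
    obtain ⟨d, hdD, f, hf, hfd⟩ := hw D hD s hs rfl
    exact ⟨d, hdD, f, ⟨hf, s, rfl, hfd.trans (hs.1 hdD)⟩, hfd⟩

/-- A finite set that meets every member of a nonempty chain of sets meets its intersection. -/
theorem IsChain.inter_sInter_nonempty {c : Set (Set α)} (hc : IsChain (· ⊆ ·) c)
    (hne : c.Nonempty) {F : Set α} (hF : F.Finite) (h : ∀ L ∈ c, (L ∩ F).Nonempty) :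
    (⋂₀ c ∩ F).Nonempty := by
  by_contra hcon
  have key : ∀ G : Set α, G.Finite → (∀ f ∈ G, f ∉ ⋂₀ c) → ∃ L ∈ c, ∀ f ∈ G, f ∉ L := by
    intro G hG
    induction G, hG using Set.Finite.induction_on with
    | empty => exact fun _ => ⟨hne.some, hne.some_mem, by simp⟩
    | @insert a G _ _ ih =>
      intro hG
      obtain ⟨L, hL, hLG⟩ := ih fun f hf => hG f (mem_insert_of_mem a hf)
      obtain ⟨M, hM, haM⟩ : ∃ M ∈ c, a ∉ M := by
        simpa [mem_sInter] using hG a (mem_insert a G)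
      rcases hc.total hL hM with hLM | hML
      · exact ⟨L, hL, by rintro f (rfl | hf); exacts [fun h => haM (hLM h), hLG f hf]⟩
      · exact ⟨M, hM, by rintro f (rfl | hf); exacts [haM, fun h => hLG f hf (hML h)]⟩
  obtain ⟨L, hL, hLF⟩ := key F hF fun f hf hfc => hcon ⟨f, hfc, hf⟩
  obtain ⟨f, hfL, hfF⟩ := h L hL
  exact hLF f hfF hfL

/-- **Rudin's lemma**, relative to a lower set `L₀`. -/
theorem DirectedFam.exists_isDirectedSet [PartialOrder α] {𝓕 : Set (Set α)}
    (hdir : DirectedFam 𝓕) (hne : 𝓕.Nonempty) (hfin : ∀ F ∈ 𝓕, F.Finite) {L₀ : Set α}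
    (hL₀ : IsLowerSet L₀) (hmeet : ∀ F ∈ 𝓕, (L₀ ∩ F).Nonempty) :
    ∃ D ⊆ L₀ ∩ ⋃₀ 𝓕, IsDirectedSet D ∧ ∀ F ∈ 𝓕, (D ∩ F).Nonempty := by
  obtain ⟨L, hLL₀, hL⟩ := zorn_superset_nonempty
    {L : Set α | IsLowerSet L ∧ ∀ F ∈ 𝓕, (L ∩ F).Nonempty}
    (fun c hcS hc hcne => ⟨⋂₀ c, ⟨isLowerSet_sInter fun L hLc => (hcS hLc).1,
      fun F hF => hc.inter_sInter_nonempty hcne (hfin F hF) fun L hLc => (hcS hLc).2 F hF⟩,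
      fun L hLc => sInter_subset_of_mem hLc⟩)
    L₀ ⟨hL₀, hmeet⟩
  obtain ⟨hlow, hLmeet⟩ := hL.prop
  have above : ∀ e ∈ L, ∃ F ∈ 𝓕, ∀ f ∈ L ∩ F, e ≤ f := by
    intro e he
    by_contra! hcon
    have hmem : L \ Ici e ∈ {L : Set α | IsLowerSet L ∧ ∀ F ∈ 𝓕, (L ∩ F).Nonempty} := by
      refine ⟨fun a b hba ha => ⟨hlow hba ha.1, fun heb => ha.2 (le_trans heb hba)⟩, ?_⟩
      intro F hF
      obtain ⟨f, hf, hef⟩ := hcon F hF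
      exact ⟨f, ⟨hf.1, hef⟩, hf.2⟩
    exact (hL.le_of_le hmem sdiff_subset he).2 le_rfl
  refine ⟨L ∩ ⋃₀ 𝓕, inter_subset_inter_left _ hLL₀, ⟨?_, ?_⟩, ?_⟩
  · obtain ⟨F, hF⟩ := hne
    obtain ⟨f, hfL, hfF⟩ := hLmeet F hF
    exact ⟨f, hfL, F, hF, hfF⟩
  · intro a ha b hb
    obtain ⟨A, hA, haA⟩ := above a ha.1
    obtain ⟨B, hB, hbB⟩ := above b hb.1
    obtain ⟨C, hC, hCAB⟩ := hdir A hA B hB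
    obtain ⟨z, hzL, hzC⟩ := hLmeet C hC
    obtain ⟨⟨p, hp, hpz⟩, q, hq, hqz⟩ := hCAB hzC
    exact ⟨z, ⟨hzL, C, hC, hzC⟩, (haA p ⟨hlow hpz hzL, hp⟩).trans hpz,
      (hbB q ⟨hlow hqz hzL, hq⟩).trans hqz⟩
  · intro F hF
    obtain ⟨f, hfL, hfF⟩ := hLmeet F hF
    exact ⟨f, ⟨hfL, F, hF, hfF⟩, hfF⟩

/-- In a dcpo, a directed family in `fin_(bl)w(x)` with intersection of upper closures `↑x`
is cofinal in the sets weakly way below `x`. -/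
theorem WWB.exists_subset_upSet [PartialOrder α] (hd : IsDcpo α) {x : α} {𝓕 : Set (Set α)}
    (hsub : 𝓕 ⊆ finBlW x) (hdir : DirectedFam 𝓕) (hne : 𝓕.Nonempty)
    (hInter : (⋂ F ∈ 𝓕, upSet F) ⊆ upSet {x}) {G : Set α} (hG : WWB G {x}) :
    ∃ F ∈ 𝓕, F ⊆ upSet G := by
  by_contra! hcon
  have hlow : IsLowerSet (upSet G)ᶜ := by
    rintro a b hba ha ⟨g, hg, hgb⟩
    exact ha ⟨g, hg, hgb.trans hba⟩
  obtain ⟨D, hDsub, hD, hDmeet⟩ := hdir.exists_isDirectedSet hne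
    (fun F hF => (hsub hF).1.1) hlow fun F hF => by
      obtain ⟨f, hf, hfG⟩ := not_subset.1 (hcon F hF)
      exact ⟨f, hfG, hf⟩
  obtain ⟨s, hs⟩ := hd D hD
  have hsx : s ≤ x := hs.2 fun d hdD => by
    obtain ⟨F, hF, hdF⟩ := (hDsub hdD).2
    obtain ⟨_, rfl, h⟩ := (hsub hF).2 hdF
    exact h
  obtain ⟨_, rfl, hxs⟩ := hInter (mem_iInter₂.2 fun F hF => by
    obtain ⟨d, hdD, hdF⟩ := hDmeet F hF
    exact ⟨d, hdF, hs.1 hdD⟩ : s ∈ ⋂ F ∈ 𝓕, upSet F)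
  obtain ⟨d, hdD, hdG⟩ := hG D hD s hs (hsx.antisymm hxs)
  exact (hDsub hdD).1 hdG

/-- A dcpo is quasiexact iff for every `x` there is a directed
subfamily `𝓕 ⊆ fin_(bl)w(x)` with `⋂ {↑F : F ∈ 𝓕} = ↑x`. -/
theorem quasiexact_iff_exists_directed_subfamily_of_finBlW [PartialOrder α]
    (hd : IsDcpo α) :
    Quasiexact α ↔
      ∀ x : α, ∃ 𝓕 : Set (Set α), 𝓕 ⊆ finBlW x ∧ DirectedFam 𝓕 ∧
        (⋂ F ∈ 𝓕, upSet F) = upSet {x} := by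
  constructor
  · intro hq x
    obtain ⟨hdir, hInter⟩ := hq x
    refine ⟨finBlW x, Subset.rfl, ?_, Subset.antisymm ?_ ?_⟩
    · intro F₁ h₁ F₂ h₂
      obtain ⟨F₃, h₃, hF₃⟩ := hdir F₁ h₁.1 F₂ h₂.1
      exact ⟨_, inter_downSet_mem_finBlW h₃, inter_subset_left.trans hF₃⟩
    · rw [← hInter]
      intro y hy
      refine mem_iInter₂.2 fun F hF => ?_
      obtain ⟨f, hf, hfy⟩ := mem_iInter₂.1 hy _ (inter_downSet_mem_finBlW hF)
      exact ⟨f, hf.1, hfy⟩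
    · exact (upSet_singleton_subset_iInter_finW x).trans
        (biInter_subset_biInter_left fun F hF => hF.1)
  · intro h x
    obtain ⟨𝓕, hsub, hdir, hInter⟩ := h x
    refine ⟨?_, Subset.antisymm ?_ (upSet_singleton_subset_iInter_finW x)⟩
    · intro F₁ h₁ F₂ h₂
      rcases 𝓕.eq_empty_or_nonempty with rfl | hne
      · have hbot : ∀ y, y ∈ upSet {x} := by simp [← hInter]
        refine ⟨{x}, ⟨finite_singleton x, singleton_nonempty x, ?_⟩, ?_⟩
        · rintro D ⟨⟨d, hdD⟩, -⟩ s - -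
          exact ⟨d, hdD, hbot d⟩
        · exact singleton_subset_iff.2 ⟨h₁.2.2.mem_upSet, h₂.2.2.mem_upSet⟩
      · obtain ⟨A, hA, hA₁⟩ := h₁.2.2.exists_subset_upSet hd hsub hdir hne hInter.subset
        obtain ⟨B, hB, hB₂⟩ := h₂.2.2.exists_subset_upSet hd hsub hdir hne hInter.subset
        obtain ⟨C, hC, hCAB⟩ := hdir A hA B hB
        refine ⟨C, (hsub hC).1, fun z hz => ?_⟩
        obtain ⟨⟨a, ha, haz⟩, b, hb, hbz⟩ := hCAB hz
        obtain ⟨p, hp, hpa⟩ := hA₁ ha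
        obtain ⟨q, hq, hqb⟩ := hB₂ hb
        exact ⟨⟨p, hp, hpa.trans haz⟩, q, hq, hqb.trans hbz⟩
    · rw [← hInter]
      exact biInter_subset_biInter_left fun F hF => (hsub hF).1
end

section
/- Every exact dcpo is quasiexact. -/
open Set TopologicalSpace

variable {α : Type*}

/-- Every exact dcpo is quasiexact. -/
theorem exact_dcpo_is_quasiexact [PartialOrder α] (hd : IsDcpo α)
    (he : ExactPoset α) : Quasiexact α := by
  intro x
  obtain ⟨hdir, hlub⟩ := he x
  refine ⟨?_, Subset.antisymm ?_ ?_⟩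
  · rintro F₁ ⟨-, -, h₁⟩ F₂ ⟨-, -, h₂⟩
    obtain ⟨d₁, hd₁, a₁, ha₁, had₁⟩ := h₁ _ hdir x hlub rfl
    obtain ⟨d₂, hd₂, a₂, ha₂, had₂⟩ := h₂ _ hdir x hlub rfl
    obtain ⟨d, hd, hd₁d, hd₂d⟩ := hdir.2 d₁ hd₁ d₂ hd₂
    refine ⟨{d}, ⟨finite_singleton d, singleton_nonempty d, hd⟩, ?_⟩
    rintro _ rfl
    exact ⟨⟨a₁, ha₁, had₁.trans hd₁d⟩, ⟨a₂, ha₂, had₂.trans hd₂d⟩⟩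
  · intro p hp
    refine ⟨x, rfl, hlub.2 fun y hy => ?_⟩
    obtain ⟨_, rfl, hyp⟩ := mem_iInter₂.1 hp {y} ⟨finite_singleton y, singleton_nonempty y, hy⟩
    exact hyp
  · rintro p ⟨_, rfl, hxp⟩
    refine mem_iInter₂.2 fun F hF => ?_
    obtain ⟨d, hd, a, ha, had⟩ := hF.2.2 _ hdir _ hlub rfl
    exact ⟨a, ha, had.trans ((hlub.1 hd).trans hxp)⟩
end

section
/- Every poset that contains no infinite antichain (i.e., no infinite set of pairwise incomparable elements) is quasiexact. -/
open Set TopologicalSpace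

variable {α : Type*}

/-- Every set contains an antichain comparable with each of its elements. -/
theorem exists_maximal_antichain_subset [PartialOrder α] (V : Set α) :
    ∃ A ⊆ V, (∀ a ∈ A, ∀ b ∈ A, a ≠ b → ¬ a ≤ b ∧ ¬ b ≤ a) ∧
      ∀ v ∈ V, ∃ a ∈ A, a ≤ v ∨ v ≤ a := by
  obtain ⟨A, hA⟩ := zorn_subset
    {A : Set α | A ⊆ V ∧ ∀ a ∈ A, ∀ b ∈ A, a ≠ b → ¬ a ≤ b ∧ ¬ b ≤ a} (by
      intro c hc hchain
      refine ⟨⋃₀ c, ⟨sUnion_subset fun s hs => (hc hs).1, ?_⟩, fun s hs => subset_sUnion_of_mem hs⟩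
      rintro a ⟨s, hs, has⟩ b ⟨t, ht, hbt⟩ hab
      rcases hchain.total hs ht with hst | hts
      · exact (hc ht).2 a (hst has) b hbt hab
      · exact (hc hs).2 a has b (hts hbt) hab)
  refine ⟨A, hA.prop.1, hA.prop.2, fun v hv => ?_⟩
  by_contra! hcon
  have hins : insert v A ⊆ A := hA.le_of_ge
    ⟨insert_subset hv hA.prop.1, by
      rintro a (rfl | ha) b (rfl | hb) hab
      · exact absurd rfl hab
      · exact (hcon b hb).symm
      · exact hcon a ha
      · exact hA.prop.2 a ha b hb hab⟩ (subset_insert v A)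
  exact (hcon v (hins (mem_insert v A))).1 le_rfl

/-- A directed set without upper bound in the finite set `A` has, above each of its elements, an
element below no member of `A`. -/
theorem IsDirectedSet.exists_ge_forall_not_le [PartialOrder α] {D : Set α} (hD : IsDirectedSet D)
    {A : Set α} (hA : A.Finite) (hub : ∀ a ∈ A, ∃ d ∈ D, ¬ d ≤ a) {d₀ : α} (hd₀ : d₀ ∈ D) :
    ∃ d ∈ D, d₀ ≤ d ∧ ∀ a ∈ A, ¬ d ≤ a := by
  induction A, hA using Set.Finite.induction_on with
  | empty => exact ⟨d₀, hd₀, le_rfl, fun a ha => absurd ha (notMem_empty a)⟩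
  | @insert a A _ _ ih =>
    obtain ⟨d, hd, h₀, hdA⟩ := ih fun b hb => hub b (mem_insert_of_mem a hb)
    obtain ⟨e, he, hea⟩ := hub a (mem_insert a A)
    obtain ⟨f, hf, hdf, hef⟩ := hD.2 d hd e he
    refine ⟨f, hf, h₀.trans hdf, ?_⟩
    rintro b (rfl | hb) hfb
    · exact hea (hef.trans hfb)
    · exact hdA b hb (hdf.trans hfb)

/-- In a poset without infinite antichains, an upper set that meets every directed set with
supremum `x` contains a member of `finW x`. -/
theorem exists_mem_finW_subset [PartialOrder α]
    (h : ∀ A : Set α, (∀ a ∈ A, ∀ b ∈ A, a ≠ b → ¬ a ≤ b ∧ ¬ b ≤ a) → A.Finite)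
    {x : α} {U : Set α} (hU : IsUpperSet U)
    (hmeet : ∀ D : Set α, IsDirectedSet D → IsLUB D x → ∃ d ∈ D, d ∈ U) :
    ∃ F ∈ finW x, F ⊆ U := by
  obtain ⟨A, hAV, hanti, hmax⟩ := exists_maximal_antichain_subset (U ∩ Iio x)
  have hxU : x ∈ U := by
    obtain ⟨d, rfl, hd⟩ := hmeet {x} ⟨singleton_nonempty x, by simp⟩ isLUB_singleton
    exact hd
  refine ⟨insert x A, ⟨(h A hanti).insert x, insert_nonempty x A, ?_⟩,
    insert_subset hxU fun a ha => (hAV ha).1⟩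
  rintro D hD s hs rfl
  by_cases hsD : s ∈ D
  · exact ⟨s, hsD, s, mem_insert s A, le_rfl⟩
  obtain ⟨d₀, hd₀, hd₀U⟩ := hmeet D hD hs
  obtain ⟨d, hd, hd₀d, hdA⟩ := hD.exists_ge_forall_not_le (h A hanti) (fun a ha => by
    by_contra! hle
    exact (hAV ha).2.not_ge (hs.2 hle)) hd₀
  have hds : d < s := (hs.1 hd).lt_of_ne fun hEq => hsD (hEq ▸ hd)
  obtain ⟨a, ha, had | hda⟩ := hmax d ⟨hU hd₀d hd₀U, hds⟩
  · exact ⟨d, hd, a, mem_insert_of_mem s ha, had⟩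
  · exact absurd hda (hdA a ha)

theorem isUpperSet_upSet [PartialOrder α] (A : Set α) : IsUpperSet (upSet A) := by
  rintro p q hpq ⟨a, ha, hap⟩
  exact ⟨a, ha, hap.trans hpq⟩

/-- Every poset with no infinite antichain is quasiexact. -/
theorem quasiexact_of_no_infinite_antichain [PartialOrder α]
    (h : ∀ A : Set α, (∀ a ∈ A, ∀ b ∈ A, a ≠ b → ¬ a ≤ b ∧ ¬ b ≤ a) → A.Finite) :
    Quasiexact α := by
  intro x
  refine ⟨fun F₁ hF₁ F₂ hF₂ => ?_, Subset.antisymm (fun y hy => ?_) ?_⟩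
  · refine exists_mem_finW_subset h ((isUpperSet_upSet F₁).inter (isUpperSet_upSet F₂)) ?_
    intro D hD hx
    obtain ⟨d₁, hd₁, h₁⟩ := hF₁.2.2 D hD x hx rfl
    obtain ⟨d₂, hd₂, h₂⟩ := hF₂.2.2 D hD x hx rfl
    obtain ⟨d, hd, hd₁d, hd₂d⟩ := hD.2 d₁ hd₁ d₂ hd₂
    exact ⟨d, hd, isUpperSet_upSet F₁ hd₁d h₁, isUpperSet_upSet F₂ hd₂d h₂⟩
  · refine ⟨x, rfl, ?_⟩
    by_contra hxy
    obtain ⟨F, hF, hFy⟩ := exists_mem_finW_subset (x := x) h (isLowerSet_Iic y).compl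
      fun D _ hx => by
        by_contra! hle
        exact hxy (hx.2 fun d hd => not_not.mp (hle d hd))
    obtain ⟨a, ha, hay⟩ := mem_iInter₂.mp hy F hF
    exact hFy ha hay
  · rintro y ⟨_, rfl, hxy⟩
    refine mem_iInter₂.mpr fun F hF => isUpperSet_upSet F hxy ?_
    obtain ⟨d, rfl, hd⟩ := hF.2.2 {_} ⟨singleton_nonempty _, by simp⟩ _ isLUB_singleton rfl
    exact hd
end

section
/- If P is a quasiexact poset, then the family B = {↟_w F : F a finite nonempty subset of P} is a basis for the topology it generates; that is, (i) for every a ∈ P there exists a finite nonempty F ⊆ P with a ∈ ↟_w F, and (ii) for any finite nonempty F₁, F₂ ⊆ P and any b ∈ ↟_w F₁ ∩ ↟_w F₂ there exists a finite nonempty F₃ ⊆ P with b ∈ ↟_w F₃ ⊆ ↟_w F₁ ∩ ↟_w F₂. -/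
open Set TopologicalSpace

variable {α : Type*}

theorem wUp_subset_wUp_of_subset_upSet [PartialOrder α] {F G : Set α} (h : F ⊆ upSet G) :
    wUp F ⊆ wUp G := by
  intro x hx D hD s hs hsx
  obtain ⟨d, hd, f, hf, hfd⟩ := hx D hD s hs hsx
  obtain ⟨g, hg, hgf⟩ := h hf
  exact ⟨d, hd, g, hg, hgf.trans hfd⟩

/-- In a quasiexact poset, `{↟_w F : F finite nonempty}` is a basis
for the topology it generates. -/
theorem quasiexact_wUp_finite_is_basis [PartialOrder α] (hq : Quasiexact α) :
    (∀ a : α, ∃ F : Set α, F.Finite ∧ F.Nonempty ∧ a ∈ wUp F) ∧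
      (∀ F₁ F₂ : Set α, F₁.Finite → F₁.Nonempty → F₂.Finite → F₂.Nonempty →
        ∀ b ∈ wUp F₁ ∩ wUp F₂,
          ∃ F₃ : Set α, F₃.Finite ∧ F₃.Nonempty ∧ b ∈ wUp F₃ ∧
            wUp F₃ ⊆ wUp F₁ ∩ wUp F₂) := by
  refine ⟨fun a => ?_, fun F₁ F₂ hF₁ hF₁' hF₂ hF₂' b hb => ?_⟩
  · by_cases h : (finW a).Nonempty
    · exact h
    · have ha : ∀ x, a ≤ x := by
        intro x
        have hx : x ∈ ⋂ F ∈ finW a, upSet F := by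
          simp [not_nonempty_iff_eq_empty.mp h]
        rw [(hq a).2] at hx
        obtain ⟨y, rfl, hy⟩ := hx
        exact hy
      exact ⟨{a}, finite_singleton a, singleton_nonempty a,
        fun D hD _ _ _ => hD.1.imp fun d hd => ⟨hd, a, rfl, ha d⟩⟩
  · obtain ⟨F₃, ⟨hfin, hne, hw⟩, hsub⟩ :=
      (hq b).1 F₁ ⟨hF₁, hF₁', hb.1⟩ F₂ ⟨hF₂, hF₂', hb.2⟩
    exact ⟨F₃, hfin, hne, hw, subset_inter
      (wUp_subset_wUp_of_subset_upSet fun _ hx => (hsub hx).1)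
      (wUp_subset_wUp_of_subset_upSet fun _ hx => (hsub hx).2)⟩
end

section
/- If P is an exact poset, then every Scott open subset of P is open in the wf topology; that is, σ(P) ⊆ τ_wf(P). -/
open Set TopologicalSpace

variable {α : Type*}

theorem wUp_subset_upSet [PartialOrder α] (G : Set α) : wUp G ⊆ upSet G := by
  intro a ha
  have hdir : IsDirectedSet ({a} : Set α) :=
    ⟨singleton_nonempty a, by rintro _ rfl _ rfl; exact ⟨_, rfl, le_rfl, le_rfl⟩⟩
  obtain ⟨d, rfl, hd⟩ := ha {a} hdir a isLUB_singleton rfl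
  exact hd

/-- If `P` is exact, then every Scott open set is open in the wf
topology: `σ(P) ⊆ τ_wf(P)`. -/
theorem scott_open_is_wf_open_of_exact [PartialOrder α] (he : ExactPoset α) :
    ∀ U : Set α, IsScottOpen U → (wfTopology α).IsOpen U := by
  rintro U ⟨hup, hU⟩
  let _ : TopologicalSpace α := wfTopology α
  refine isOpen_iff_forall_mem_open.2 fun x hx => ?_
  obtain ⟨y, hyx, hyU⟩ := hU _ (he x).1 x (he x).2 hx
  refine ⟨wUp {y}, fun a ha => ?_,
    isOpen_generateFrom_of_mem ⟨{y}, finite_singleton y, singleton_nonempty y, rfl⟩, hyx⟩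
  obtain ⟨_, rfl, hya⟩ := wUp_subset_upSet _ ha
  exact hup ▸ ⟨_, hyU, hya⟩
end

section
/- If P is a moderately meet continuous poset and F is a finite nonempty subset of P, then the interior of ↑F in the wf topology is contained in ⋃{↟_w x : x ∈ F}. -/
open Set TopologicalSpace

variable {α : Type*}

/-- In a moderately meet continuous poset, if no point of a finite set `G` is weakly way below
`y`, then every wf-open neighbourhood of `y` contains a point below `y` and outside `↑G`. -/
theorem ModMeetCont.exists_mem_le_forall_not_le [PartialOrder α] (hmmc : ModMeetCont α)
    {U : Set α} (hU : @IsOpen α (wfTopology α) U) {y : α} (hy : y ∈ U) {G : Set α} (hG : G.Finite)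
    (hGy : ∀ x ∈ G, ¬ WWB {x} {y}) : ∃ z ∈ U, z ≤ y ∧ ∀ x ∈ G, ¬ x ≤ z := by
  induction G, hG using Set.Finite.induction_on with
  | empty => exact ⟨y, hy, le_rfl, by simp⟩
  | @insert a G _ _ ih =>
    obtain ⟨z, hzU, hzy, hz⟩ := ih fun x hx => hGy x (mem_insert_of_mem a hx)
    have ha := hGy a (mem_insert a G)
    simp only [WWB, upSet, mem_singleton_iff, exists_eq_left, mem_ofPred_eq] at ha
    push Not at ha
    obtain ⟨D, hD, s, hs, rfl, hDa⟩ := ha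
    obtain ⟨w, hwU, ⟨d, hd, hwd⟩, z', hz', hwz⟩ :=
      (@mem_closure_iff α (wfTopology α) _ _).1 (hmmc z D hD s hs hzy) U hU hzU
    obtain rfl : z' = z := hz'
    refine ⟨w, hwU, hwz.trans hzy, ?_⟩
    rintro x (rfl | hx) hxw
    · exact hDa d hd (hxw.trans hwd)
    · exact hz x hx (hxw.trans hwz)

/-- In a moderately meet continuous poset, the wf-interior of `↑F`
is contained in `⋃ {↟_w x : x ∈ F}` for finite nonempty `F`. -/
theorem wf_interior_upSet_subset_union_wUp [PartialOrder α]
    (hmmc : ModMeetCont α) (F : Set α) (hF : F.Finite) (hFne : F.Nonempty) :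
    @interior α (wfTopology α) (upSet F) ⊆ ⋃ x ∈ F, wUp {x} := by
  intro y hy
  by_contra hcon
  simp only [mem_iUnion, wUp, mem_ofPred_eq, not_exists] at hcon
  obtain ⟨z, hzU, -, hz⟩ := hmmc.exists_mem_le_forall_not_le
    (@isOpen_interior α (wfTopology α) (upSet F)) hy hF hcon
  obtain ⟨x, hx, hxz⟩ := @interior_subset α (wfTopology α) (upSet F) z hzU
  exact hz x hx hxz
end

section
/- For a nonempty subset F of a poset P and an element x ∈ P: F ≪_w x if and only if ↓x ∩ F is nonempty and ↓x ∩ F ≪_w x. -/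
open Set TopologicalSpace

variable {α : Type*}

/-- `F ≪_w x` iff `↓x ∩ F` is nonempty and `↓x ∩ F ≪_w x`. -/
theorem wwb_iff_downSet_inter_wwb [PartialOrder α] (F : Set α) (hF : F.Nonempty)
    (x : α) :
    WWB F {x} ↔ (downSet {x} ∩ F).Nonempty ∧ WWB (downSet {x} ∩ F) {x} := by
  constructor
  · intro h
    have below : WWB (downSet {x} ∩ F) {x} := by
      rintro D hD s hs rfl
      obtain ⟨d, hd, a, ha, had⟩ := h D hD s hs rfl
      exact ⟨d, hd, a, ⟨⟨s, rfl, had.trans (hs.1 hd)⟩, ha⟩, had⟩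
    have directed : IsDirectedSet {x} := by
      refine ⟨singleton_nonempty x, ?_⟩
      rintro _ rfl _ rfl
      exact ⟨_, rfl, le_rfl, le_rfl⟩
    obtain ⟨_, _, a, ha, _⟩ := below {x} directed x isLUB_singleton rfl
    exact ⟨⟨a, ha⟩, below⟩
  · rintro ⟨_, h⟩ D hD s hs hx
    obtain ⟨d, hd, a, ha, had⟩ := h D hD s hs hx
    exact ⟨d, hd, a, ha.2, had⟩
end

section
/- Let P be a dcpo, let G be a nonempty subset of P and let x ∈ P with G ≪_w x. If 𝓕 is a directed family of nonempty finite subsets F ⊆ ↓x such that ⋂_{F ∈ 𝓕} ↑F ⊆ ↑x, then there exists F₀ ∈ 𝓕 with F₀ ⊆ ↑G. -/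
open Set TopologicalSpace

variable {α : Type*}

/-- The intersection of a chain of sets that all meet a finite set `F` meets `F`. -/
theorem IsChain.sInter_inter_nonempty {c : Set (Set α)} (hc : IsChain (· ⊆ ·) c)
    (hne : c.Nonempty) {F : Set α} (hF : F.Finite) (hcF : ∀ K ∈ c, (K ∩ F).Nonempty) :
    (⋂₀ c ∩ F).Nonempty := by
  obtain ⟨K, hK, hmin⟩ :=
    exists_minimalFor_of_wellFoundedLT (· ∈ c) (fun K => (K ∩ F).ncard) hne
  obtain ⟨a, haK, haF⟩ := hcF K hK
  refine ⟨a, fun L hL => ?_, haF⟩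
  rcases hc.total hK hL with h | h
  · exact h haK
  · have hsub : L ∩ F ⊆ K ∩ F := inter_subset_inter_left F h
    have hle : (L ∩ F).ncard ≤ (K ∩ F).ncard := ncard_le_ncard hsub (hF.inter_of_right K)
    have heq : L ∩ F = K ∩ F :=
      eq_of_subset_of_ncard_le hsub (hmin hL hle) (hF.inter_of_right K)
    exact (heq.symm ▸ (⟨haK, haF⟩ : a ∈ K ∩ F) : a ∈ L ∩ F).1

/-- Rudin's lemma: a lower set meeting every member of a directed family of finite sets
contains a directed set meeting every member of the family. -/
theorem DirectedFam.exists_isDirectedSet_subset [PartialOrder α] {𝓕 : Set (Set α)}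
    (h𝓕 : DirectedFam 𝓕) (hne : 𝓕.Nonempty) (hfin : ∀ F ∈ 𝓕, F.Finite) {L : Set α}
    (hL : IsLowerSet L) (hLF : ∀ F ∈ 𝓕, (L ∩ F).Nonempty) :
    ∃ D ⊆ L, IsDirectedSet D ∧ ∀ F ∈ 𝓕, (D ∩ F).Nonempty := by
  obtain ⟨K, hKL, hK⟩ := zorn_superset_nonempty
    {K : Set α | IsLowerSet K ∧ ∀ F ∈ 𝓕, (K ∩ F).Nonempty}
    (fun c hcS hc hcne => ⟨⋂₀ c, ⟨isLowerSet_sInter fun K hK => (hcS hK).1,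
      fun F hF => hc.sInter_inter_nonempty hcne (hfin F hF) fun K hK => (hcS hK).2 F hF⟩,
      fun _ => sInter_subset_of_mem⟩) L ⟨hL, hLF⟩
  obtain ⟨hlow, hmeet⟩ := hK.prop
  have key : ∀ a ∈ K, ∃ F ∈ 𝓕, ∀ f ∈ K ∩ F, a ≤ f := by
    intro a ha
    by_contra! h
    have hmem : K \ Ici a ∈ {K : Set α | IsLowerSet K ∧ ∀ F ∈ 𝓕, (K ∩ F).Nonempty} := by
      refine ⟨fun p q hqp hp => ⟨hlow hqp hp.1, fun hq => hp.2 (le_trans hq hqp)⟩,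
        fun F hF => ?_⟩
      obtain ⟨f, hf, haf⟩ := h F hF
      exact ⟨f, ⟨hf.1, haf⟩, hf.2⟩
    exact (hK.le_of_le hmem sdiff_subset ha).2 le_rfl
  obtain ⟨F, hF⟩ := hne
  refine ⟨K, hKL, ⟨(hmeet F hF).left, fun a ha b hb => ?_⟩, hmeet⟩
  obtain ⟨F₁, hF₁, ha₁⟩ := key a ha
  obtain ⟨F₂, hF₂, hb₂⟩ := key b hb
  obtain ⟨F₃, hF₃, hsub⟩ := h𝓕 F₁ hF₁ F₂ hF₂
  obtain ⟨c, hcK, hcF⟩ := hmeet F₃ hF₃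
  obtain ⟨⟨f, hf, hfc⟩, ⟨g, hg, hgc⟩⟩ := hsub hcF
  exact ⟨c, hcK, (ha₁ f ⟨hlow hfc hcK, hf⟩).trans hfc,
    (hb₂ g ⟨hlow hgc hcK, hg⟩).trans hgc⟩

/-- Rudin-type lemma: if `G ≪_w x` and `𝓕` is a directed family of
nonempty finite subsets of `↓x` with `⋂_{F ∈ 𝓕} ↑F ⊆ ↑x`, then some `F₀ ∈ 𝓕` is
contained in `↑G`. -/
theorem exists_mem_subset_upSet_of_wwb [PartialOrder α] (hd : IsDcpo α)
    (G : Set α) (hG : G.Nonempty) (x : α) (hGx : WWB G {x}) (𝓕 : Set (Set α))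
    (h𝓕ne : 𝓕.Nonempty) (h𝓕 : DirectedFam 𝓕)
    (hF : ∀ F ∈ 𝓕, F.Finite ∧ F.Nonempty ∧ F ⊆ downSet {x})
    (hcap : (⋂ F ∈ 𝓕, upSet F) ⊆ upSet {x}) :
    ∃ F₀ ∈ 𝓕, F₀ ⊆ upSet G := by
  by_contra! h
  have hlow : IsLowerSet (Iic x \ upSet G) := fun p q hqp hp =>
    ⟨le_trans hqp hp.1, fun ⟨g, hg, hgq⟩ => hp.2 ⟨g, hg, hgq.trans hqp⟩⟩
  have hmeet : ∀ F ∈ 𝓕, ((Iic x \ upSet G) ∩ F).Nonempty := by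
    intro F hF'
    obtain ⟨f, hf, hfG⟩ := not_subset.1 (h F hF')
    obtain ⟨y, rfl, hfy⟩ := (hF F hF').2.2 hf
    exact ⟨f, ⟨hfy, hfG⟩, hf⟩
  obtain ⟨D, hDL, hD, hDF⟩ :=
    h𝓕.exists_isDirectedSet_subset h𝓕ne (fun F hF' => (hF F hF').1) hlow hmeet
  obtain ⟨s, hs⟩ := hd D hD
  have hsx : s ≤ x := hs.2 fun d hdD => (hDL hdD).1
  have hxs : x ≤ s := by
    obtain ⟨y, rfl, hy⟩ := hcap (mem_iInter₂.2 fun F hF' => by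
      obtain ⟨d, hdD, hdF⟩ := hDF F hF'
      exact ⟨d, hdF, hs.1 hdD⟩)
    exact hy
  obtain ⟨d, hdD, hdG⟩ := hGx D hD s hs (le_antisymm hsx hxs)
  exact (hDL hdD).2 hdG
end
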